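/- For every epsilon > 0 and every function f : N -> R with f(q) -> infinity, there exist an integer gamma >= 2 and an integer sequence L_n >= 2 with L_n -> infinity such that the subshift built with constant gamma_n = gamma and cut sequence L_n satisfies limsup_{q -> infinity} p(q)/q < 3/2 + epsilon and p(h_n) < h_n + f(h_n) for all n >= 2. -/

import Mathlib

/-- The word sequence `B 1 = 0`, `B (n+1) = ((B n 1)^{γ n} B n)^{L n}` over the alphabet
`{0,1}` (encoded as `Bool` with `false = 0`, `true = 1`). The value at `0` is an
irrelevant placeholder. -/
def Cseq (L γ : ℕ → ℕ) : ℕ → List Bool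
  | 0 => [false]
  | 1 => [false]
  | n + 2 =>
      (List.replicate (L (n + 1))
        ((List.replicate (γ (n + 1)) (Cseq L γ (n + 1) ++ [true])).flatten ++
          Cseq L γ (n + 1))).flatten

/-- The language: all factors of some `B n`. -/
def InLangC (L γ : ℕ → ℕ) (w : List Bool) : Prop :=
  ∃ n, w <:+: Cseq L γ n

/-- The word complexity: the number of words of length `q` in the language. -/
noncomputable def complexityC (L γ : ℕ → ℕ) (q : ℕ) : ℕ :=
  Set.ncard {w : List Bool | w.length = q ∧ InLangC L γ w}

/-- A word `w` is right-special if both `w0` and `w1` belong to the language. -/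
def RightSpecialC (L γ : ℕ → ℕ) (w : List Bool) : Prop :=
  InLangC L γ (w ++ [false]) ∧ InLangC L γ (w ++ [true])

open Filter

/-- The optional spacer symbol: `1` if `b` is true, nothing otherwise. -/
def spacer (b : Bool) : List Bool := if b then [true] else []

/-- Copies of `X` separated by the spacers prescribed by a list of bits. -/
def spaced (X : List Bool) : List Bool → List Bool
  | [] => X
  | b :: l => X ++ spacer b ++ spaced X l

/-- The spacer pattern, with respect to `X`, of `spaced (spaced X a) l`. -/
def nestPattern (a : List Bool) : List Bool → List Bool
  | [] => a
  | b :: l => a ++ b :: nestPattern a l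

/-- The word of length `q` read in `U` from position `i`. -/
def window (U : List Bool) (i q : ℕ) : List Bool := (U.drop i).take q

theorem spaced_append (X a : List Bool) (b : Bool) (c : List Bool) :
    spaced X (a ++ b :: c) = spaced X a ++ spacer b ++ spaced X c := by
  induction a with
  | nil => simp [spaced]
  | cons d a ih => simp [spaced, ih]

theorem spaced_spaced (X a l : List Bool) :
    spaced (spaced X a) l = spaced X (nestPattern a l) := by
  induction l with
  | nil => rfl
  | cons b l ih => simp [spaced, nestPattern, spaced_append, ih]

theorem prefix_spaced (X l : List Bool) : X <+: spaced X l := by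
  cases l with
  | nil => exact List.prefix_refl X
  | cons b l => simp [spaced]

theorem isChain_nestPattern (b : Bool) (k : ℕ) (l : List Bool) :
    List.IsChain (fun x y => x = b ∨ y = b) (nestPattern (List.replicate (k + 1) b) l) := by
  have aux : ∀ (j : ℕ) (t : List Bool), List.IsChain (fun x y => x = b ∨ y = b) t →
      List.IsChain (fun x y => x = b ∨ y = b) (List.replicate j b ++ t) := by
    intro j t ht
    induction j with
    | zero => simpa using ht
    | succ j ih =>
      rw [List.replicate_succ, List.cons_append, List.isChain_cons]
      exact ⟨fun y _ => Or.inl rfl, ih⟩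
  induction l with
  | nil => simpa [nestPattern] using aux (k + 1) [] List.IsChain.nil
  | cons c l ih =>
    rw [nestPattern]
    refine aux _ _ ?_
    rw [List.isChain_cons]
    refine ⟨?_, ih⟩
    intro y hy
    right
    cases l <;> simp [nestPattern, List.replicate_succ] at hy <;> exact hy.symm

theorem flatten_replicate_append (X : List Bool) (b : Bool) (k : ℕ) :
    (List.replicate k (X ++ spacer b)).flatten ++ X = spaced X (List.replicate k b) := by
  induction k with
  | zero => simp [spaced]
  | succ k ih => simp [List.replicate_succ, spaced, ← ih]

theorem length_spaced_replicate (X : List Bool) (b : Bool) (k : ℕ) :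
    (spaced X (List.replicate k b)).length = k * (X.length + b.toNat) + X.length := by
  induction k with
  | zero => simp [spaced]
  | succ k ih =>
    cases b <;> simp [List.replicate_succ, spaced, spacer, ih] <;> ring

theorem infix_iff_window {w U : List Bool} :
    w <:+: U ↔ ∃ i, i + w.length ≤ U.length ∧ w = window U i w.length := by
  constructor
  · rintro ⟨s, t, rfl⟩
    exact ⟨s.length, by simp, by simp [window]⟩
  · rintro ⟨i, -, h⟩
    rw [h]
    exact (List.take_prefix _ _).isInfix.trans (List.drop_suffix _ _).isInfix

theorem window_append_left {A D : List Bool} {i q : ℕ} (h : i + q ≤ A.length) :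
    window (A ++ D) i q = window A i q := by
  rw [window, window, List.drop_append_of_le_length (by omega), List.take_append_of_le_length]
  simp; omega

theorem window_append_right {A D : List Bool} {i q : ℕ} (h : A.length ≤ i) :
    window (A ++ D) i q = window D (i - A.length) q := by
  rw [window, window, List.drop_append, List.drop_eq_nil_of_le h, List.nil_append]

/-- If `U` has period `p`, its factors are read from the first `p` positions. -/
theorem exists_window_of_period {U : List Bool} {p : ℕ} (hp : 0 < p) (hU : U.drop p <+: U)
    {w : List Bool} (hw : w <:+: U) : ∃ i < p, w = window U i w.length := by
  rw [infix_iff_window] at hw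
  obtain ⟨i, hi, h⟩ := hw
  induction i using Nat.strong_induction_on with
  | _ i ih =>
    by_cases hip : i < p
    · exact ⟨i, hip, h⟩
    · refine ih (i - p) (by omega) (by omega) (h.trans ?_)
      have hlen : i - p + w.length ≤ (U.drop p).length := by rw [List.length_drop]; omega
      obtain ⟨t, ht⟩ := hU
      conv_rhs => rw [← ht]
      rw [window_append_left hlen, window, window, List.drop_drop]
      congr 2
      omega

theorem drop_spaced_replicate (X : List Bool) (b : Bool) (k : ℕ) :
    (spaced X (List.replicate k b)).drop (X.length + b.toNat) <+:
      spaced X (List.replicate k b) := by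
  cases k with
  | zero =>
    have h : X.drop (X.length + b.toNat) = [] := List.drop_eq_nil_of_le (by omega)
    simp [spaced, h]
  | succ k =>
    have h : X.length + b.toNat = (X ++ spacer b).length := by cases b <;> simp [spacer]
    rw [h, List.replicate_succ, spaced, List.drop_left, ← spaced, ← List.replicate_succ,
      List.replicate_succ', spaced_append, List.append_assoc]
    exact List.prefix_append _ _

theorem length_spacer (b : Bool) : (spacer b).length = b.toNat := by cases b <;> rfl

theorem infix_of_spaced_short {X l w : List Bool} (hw : w.length ≤ X.length)
    (h : w <:+: spaced X l) (b : Bool) : w <:+: spaced X [b] ∨ w <:+: spaced X [!b] := by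
  suffices ∃ s, w <:+: spaced X [s] by
    obtain ⟨s, hs⟩ := this
    by_cases hsb : s = b
    · exact Or.inl (hsb ▸ hs)
    · exact Or.inr ((Bool.eq_not.mpr hsb) ▸ hs)
  induction l with
  | nil => exact ⟨b, h.trans (prefix_spaced X [b]).isInfix⟩
  | cons s l ih =>
    rw [infix_iff_window] at h
    obtain ⟨i, hi, h⟩ := h
    rw [spaced] at h
    by_cases his : i < (X ++ spacer s).length
    · obtain ⟨t, ht⟩ := prefix_spaced X l
      refine ⟨s, infix_iff_window.mpr ⟨i, ?_, ?_⟩⟩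
      · simp [spaced] at his ⊢; omega
      · rw [← ht, ← List.append_assoc, window_append_left] at h
        · simpa [spaced] using h
        · simp at his ⊢; omega
    · rw [window_append_right (by omega)] at h
      refine ih (infix_iff_window.mpr ⟨_, ?_, h⟩)
      simp [spaced] at hi his ⊢; omega

theorem infix_of_spaced_long {X l w : List Bool} {b : Bool} (hw : w.length ≤ 2 * X.length)
    (hl : List.IsChain (fun x y => x = b ∨ y = b) l) (h : w <:+: spaced X l) :
    w <:+: spaced X [b, b] ∨ w <:+: spaced X [!b] ∨ w <:+: spaced X [b, !b] ∨
      w <:+: spaced X [!b, b] := by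
  induction l with
  | nil => exact Or.inl (h.trans (prefix_spaced X [b, b]).isInfix)
  | cons s l ih =>
    cases l with
    | nil =>
      by_cases hs : s = b
      · subst hs
        refine Or.inl (h.trans (List.IsPrefix.isInfix ?_))
        simp [spaced]
      · rw [Bool.eq_not.mpr hs] at h
        exact Or.inr (Or.inl h)
    | cons s' l =>
      rw [List.isChain_cons_cons] at hl
      rw [infix_iff_window] at h
      obtain ⟨i, hi, h⟩ := h
      rw [spaced] at h
      by_cases his : i < (X ++ spacer s).length
      · have key : w <:+: spaced X [s, s'] := by
          obtain ⟨t, ht⟩ := prefix_spaced X l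
          refine infix_iff_window.mpr ⟨i, ?_, ?_⟩
          · simp [spaced] at his ⊢; omega
          · have e : X ++ spacer s ++ spaced X (s' :: l) = spaced X [s, s'] ++ t := by
              simp [spaced, ← ht]
            rw [e, window_append_left] at h
            · exact h
            · simp [spaced] at his ⊢; omega
        by_cases hs : s = b
        · by_cases hs' : s' = b
          · rw [hs, hs'] at key; exact Or.inl key
          · rw [hs, Bool.eq_not.mpr hs'] at key; exact Or.inr (Or.inr (Or.inl key))
        · rw [Bool.eq_not.mpr hs, hl.1.resolve_left hs] at key
          exact Or.inr (Or.inr (Or.inr key))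
      · rw [window_append_right (by omega)] at h
        refine ih hl.2 (infix_iff_window.mpr ⟨_, ?_, h⟩)
        simp [spaced] at hi his ⊢; omega

theorem crossing_one {X w : List Bool} {s : Bool} (h : w <:+: spaced X [s]) :
    w <:+: X ∨ ∃ i ∈ Finset.Ico (X.length + 1 - w.length) (X.length + s.toNat),
      w = window (spaced X [s]) i w.length := by
  obtain ⟨i, hi, h⟩ := infix_iff_window.mp h
  by_cases h1 : i + w.length ≤ X.length
  · left
    rw [spaced, List.append_assoc, window_append_left h1] at h
    exact infix_iff_window.mpr ⟨i, h1, h⟩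
  by_cases h2 : X.length + s.toNat ≤ i
  · left
    have h2' : (X ++ spacer s).length ≤ i := by simpa [length_spacer] using h2
    rw [spaced, window_append_right h2', spaced] at h
    refine infix_iff_window.mpr ⟨_, ?_, h⟩
    simp [spaced, length_spacer] at hi ⊢; omega
  · exact Or.inr ⟨i, by simp; omega, h⟩

theorem crossing_two {X w : List Bool} {s t : Bool} (h : w <:+: spaced X [s, t]) :
    w <:+: spaced X [s] ∨ w <:+: spaced X [t] ∨
      ∃ i ∈ Finset.Ico (2 * X.length + s.toNat + 1 - w.length) (X.length + s.toNat),
        w = window (spaced X [s, t]) i w.length := by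
  obtain ⟨i, hi, h⟩ := infix_iff_window.mp h
  by_cases h1 : i + w.length ≤ 2 * X.length + s.toNat
  · left
    have e : spaced X [s, t] = spaced X [s] ++ (spacer t ++ X) := by simp [spaced]
    rw [e, window_append_left (by simp [spaced, length_spacer]; omega)] at h
    exact infix_iff_window.mpr ⟨i, by simp [spaced, length_spacer]; omega, h⟩
  by_cases h2 : X.length + s.toNat ≤ i
  · right; left
    have h2' : (X ++ spacer s).length ≤ i := by simpa [length_spacer] using h2
    rw [spaced, window_append_right h2'] at h
    refine infix_iff_window.mpr ⟨_, ?_, h⟩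
    simp [spaced, length_spacer] at hi ⊢; omega
  · exact Or.inr (Or.inr ⟨i, by simp; omega, h⟩)

theorem ncard_le_of_short {S : Set (List Bool)} {Z : List Bool} {r q : ℕ} {b : Bool}
    (hZ : 0 < Z.length)
    (hq : 0 < q) (hqX : q ≤ (spaced Z (List.replicate r !b)).length)
    (hS : ∀ w ∈ S, w.length = q ∧ ∃ l, w <:+: spaced (spaced Z (List.replicate r !b)) l) :
    S.ncard ≤ Z.length + q := by
  classical
  set X := spaced Z (List.replicate r !b) with hX
  have e : spaced X [!b] = spaced Z (List.replicate (r + 1 + r) !b) := by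
    rw [hX, spaced_spaced, nestPattern, nestPattern, ← List.replicate_succ,
      List.replicate_append_replicate]
    congr 2; ring
  let T : Finset (List Bool) :=
    (Finset.range (Z.length + (!b).toNat)).image (fun i => window (spaced X [!b]) i q) ∪
    (Finset.Ico (X.length + 1 - q) (X.length + b.toNat)).image
      (fun i => window (spaced X [b]) i q)
  have hsub : S ⊆ (T : Set (List Bool)) := by
    intro w hw
    obtain ⟨rfl, l, hl⟩ := hS w hw
    have hper : w <:+: spaced X [!b] → w ∈ (T : Set (List Bool)) := by
      intro h
      rw [e] at h
      obtain ⟨i, hi, h⟩ := exists_window_of_period (by omega) (drop_spaced_replicate _ _ _) h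
      rw [← e] at h
      simp only [T, Finset.coe_union, Set.mem_union, Finset.mem_coe, Finset.mem_image]
      exact Or.inl ⟨i, by simpa using hi, h.symm⟩
    rcases infix_of_spaced_short hqX hl b with h | h
    · rcases crossing_one h with h | ⟨i, hi, h⟩
      · exact hper (h.trans (prefix_spaced _ _).isInfix)
      · simp only [T, Finset.coe_union, Set.mem_union, Finset.mem_coe, Finset.mem_image]
        exact Or.inr ⟨i, hi, h.symm⟩
    · exact hper h
  have h1 : S.ncard ≤ T.card := by
    rw [← Set.ncard_coe_finset]
    exact Set.ncard_le_ncard hsub T.finite_toSet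
  have h2 : T.card ≤ (Z.length + (!b).toNat) + (X.length + b.toNat - (X.length + 1 - q)) := by
    refine (Finset.card_union_le _ _).trans (add_le_add ?_ ?_)
    · exact Finset.card_image_le.trans (by simp)
    · exact Finset.card_image_le.trans (by simp)
  have h3 : (!b).toNat + b.toNat = 1 := by cases b <;> rfl
  omega

theorem ncard_le_of_long {S : Set (List Bool)} {Z : List Bool} {r q : ℕ} {b : Bool}
    (hZ : 0 < Z.length)
    (hqX : q ≤ 2 * (spaced Z (List.replicate r !b)).length)
    (hS : ∀ w ∈ S, w.length = q ∧ ∃ l, List.IsChain (fun x y => x = b ∨ y = b) l ∧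
      w <:+: spaced (spaced Z (List.replicate r !b)) l) :
    S.ncard ≤ (spaced Z (List.replicate r !b)).length + Z.length + 1 +
      2 * (q - (spaced Z (List.replicate r !b)).length - 1) := by
  classical
  set X := spaced Z (List.replicate r !b) with hX
  have hXpos : 0 < X.length := hZ.trans_le (prefix_spaced _ _).length_le
  have e : spaced X [!b] = spaced Z (List.replicate (r + 1 + r) !b) := by
    rw [hX, spaced_spaced, nestPattern, nestPattern, ← List.replicate_succ,
      List.replicate_append_replicate]
    congr 2; ring
  let T : Finset (List Bool) :=
    ((Finset.range (Z.length + (!b).toNat)).image (fun i => window (spaced X [!b]) i q) ∪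
    (Finset.range (X.length + b.toNat)).image (fun i => window (spaced X [b, b]) i q)) ∪
    ((Finset.Ico (2 * X.length + b.toNat + 1 - q) (X.length + b.toNat)).image
      (fun i => window (spaced X [b, !b]) i q) ∪
    (Finset.Ico (2 * X.length + (!b).toNat + 1 - q) (X.length + (!b).toNat)).image
      (fun i => window (spaced X [!b, b]) i q))
  have hsub : S ⊆ (T : Set (List Bool)) := by
    intro w hw
    obtain ⟨rfl, l, hc, hl⟩ := hS w hw
    have hper : w <:+: spaced X [!b] → w ∈ (T : Set (List Bool)) := by
      intro h
      rw [e] at h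
      obtain ⟨i, hi, h⟩ := exists_window_of_period (by omega) (drop_spaced_replicate _ _ _) h
      rw [← e] at h
      simp only [T, Finset.coe_union, Set.mem_union, Finset.mem_coe, Finset.mem_image]
      exact Or.inl (Or.inl ⟨i, by simpa using hi, h.symm⟩)
    have hper' : w <:+: spaced X [b, b] → w ∈ (T : Set (List Bool)) := by
      intro h
      obtain ⟨i, hi, h⟩ := exists_window_of_period (p := X.length + b.toNat) (by omega)
        (drop_spaced_replicate X b 2) h
      simp only [T, Finset.coe_union, Set.mem_union, Finset.mem_coe, Finset.mem_image]
      exact Or.inl (Or.inr ⟨i, by simpa using hi, h.symm⟩)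
    have hpre : w <:+: spaced X [b] → w ∈ (T : Set (List Bool)) := by
      intro h
      exact hper' (h.trans (List.IsPrefix.isInfix (by simp [spaced])))
    rcases infix_of_spaced_long hqX hc hl with h | h | h | h
    · exact hper' h
    · exact hper h
    · rcases crossing_two h with h | h | ⟨i, hi, h⟩
      · exact hpre h
      · exact hper h
      · simp only [T, Finset.coe_union, Set.mem_union, Finset.mem_coe, Finset.mem_image]
        exact Or.inr (Or.inl ⟨i, hi, h.symm⟩)
    · rcases crossing_two h with h | h | ⟨i, hi, h⟩
      · exact hper h
      · exact hpre h
      · simp only [T, Finset.coe_union, Set.mem_union, Finset.mem_coe, Finset.mem_image]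
        exact Or.inr (Or.inr ⟨i, hi, h.symm⟩)
  have h1 : S.ncard ≤ T.card := by
    rw [← Set.ncard_coe_finset]
    exact Set.ncard_le_ncard hsub T.finite_toSet
  have h2 : T.card ≤ ((Z.length + (!b).toNat) + (X.length + b.toNat)) +
      ((X.length + b.toNat - (2 * X.length + b.toNat + 1 - q)) +
       (X.length + (!b).toNat - (2 * X.length + (!b).toNat + 1 - q))) := by
    refine (Finset.card_union_le _ _).trans (add_le_add
      ((Finset.card_union_le _ _).trans (add_le_add ?_ ?_))
      ((Finset.card_union_le _ _).trans (add_le_add ?_ ?_))) <;>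
    exact Finset.card_image_le.trans (by simp)
  have h3 : (!b).toNat + b.toNat = 1 := by cases b <;> rfl
  omega

/-- The word `(B_n 1)^{γ_n} B_n`, of which `B_{n+1}` is a power. -/
def runWord (L γ : ℕ → ℕ) (n : ℕ) : List Bool :=
  spaced (Cseq L γ n) (List.replicate (γ n) true)

section Language

variable {L γ : ℕ → ℕ}

theorem Cseq_succ (hL : ∀ n, 1 ≤ n → 2 ≤ L n) (n : ℕ) :
    Cseq L γ (n + 2) =
      spaced (runWord L γ (n + 1)) (List.replicate (L (n + 1) - 1) false) := by
  have h2 := hL (n + 1) (by omega)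
  obtain ⟨k, hk⟩ : ∃ k, L (n + 1) = k + 1 := ⟨L (n + 1) - 1, by omega⟩
  have e : (List.replicate (γ (n + 1)) (Cseq L γ (n + 1) ++ [true])).flatten ++
      Cseq L γ (n + 1) = runWord L γ (n + 1) :=
    flatten_replicate_append (Cseq L γ (n + 1)) true (γ (n + 1))
  rw [Cseq, e, hk, Nat.add_sub_cancel, List.replicate_succ', List.flatten_append,
    ← flatten_replicate_append]
  simp [spacer]

theorem exists_Cseq_eq_spaced (hL : ∀ n, 1 ≤ n → 2 ≤ L n) {n m : ℕ} (hn : 1 ≤ n)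
    (hnm : n ≤ m) : ∃ l, Cseq L γ m = spaced (Cseq L γ n) l := by
  induction m, hnm using Nat.le_induction with
  | base => exact ⟨[], rfl⟩
  | succ m hm ih =>
    obtain ⟨l, hl⟩ := ih
    obtain ⟨k, rfl⟩ : ∃ k, m = k + 1 := ⟨m - 1, by omega⟩
    rw [Cseq_succ hL, runWord, hl, spaced_spaced, spaced_spaced]
    exact ⟨_, rfl⟩

theorem exists_infix_spaced_Cseq (hL : ∀ n, 1 ≤ n → 2 ≤ L n) {n : ℕ} (hn : 1 ≤ n)
    {w : List Bool} (hw : InLangC L γ w) : ∃ l, w <:+: spaced (Cseq L γ n) l := by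
  obtain ⟨N, hN⟩ := hw
  wlog hN1 : 1 ≤ N generalizing N
  · obtain rfl : N = 0 := by omega
    exact this 1 hN le_rfl
  rcases le_total n N with h | h
  · obtain ⟨l, hl⟩ := exists_Cseq_eq_spaced (γ := γ) hL hn h
    exact ⟨l, hl ▸ hN⟩
  · obtain ⟨l, hl⟩ := exists_Cseq_eq_spaced (γ := γ) hL hN1 h
    exact ⟨[], hN.trans (hl ▸ (prefix_spaced (Cseq L γ N) l).isInfix)⟩

theorem exists_infix_spaced_runWord (hL : ∀ n, 1 ≤ n → 2 ≤ L n) {n : ℕ} (hn : 1 ≤ n)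
    {w : List Bool} (hw : InLangC L γ w) :
    ∃ l, List.IsChain (fun x y => x = false ∨ y = false) l ∧
      w <:+: spaced (runWord L γ n) l := by
  obtain ⟨l, hl⟩ := exists_infix_spaced_Cseq hL (n := n + 1) (by omega) hw
  obtain ⟨k, rfl⟩ : ∃ k, n = k + 1 := ⟨n - 1, by omega⟩
  have h2 := hL (k + 1) (by omega)
  rw [Cseq_succ hL, spaced_spaced] at hl
  refine ⟨_, ?_, hl⟩
  have e : L (k + 1) - 1 = L (k + 1) - 2 + 1 := by omega
  rw [e]
  exact isChain_nestPattern _ _ _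

theorem exists_infix_spaced_Cseq_isChain (hL : ∀ n, 1 ≤ n → 2 ≤ L n)
    (hγ : ∀ n, 1 ≤ γ n) {n : ℕ} (hn : 1 ≤ n) {w : List Bool} (hw : InLangC L γ w) :
    ∃ l, List.IsChain (fun x y => x = true ∨ y = true) l ∧
      w <:+: spaced (Cseq L γ n) l := by
  obtain ⟨l, -, hl⟩ := exists_infix_spaced_runWord hL hn hw
  rw [runWord, spaced_spaced] at hl
  refine ⟨_, ?_, hl⟩
  rw [← Nat.sub_add_cancel (hγ n)]
  exact isChain_nestPattern _ _ _

theorem length_Cseq_pos (hL : ∀ n, 1 ≤ n → 2 ≤ L n) (n : ℕ) : 0 < (Cseq L γ n).length := by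
  match n with
  | 0 => simp [Cseq]
  | n + 1 =>
    obtain ⟨l, hl⟩ := exists_Cseq_eq_spaced (γ := γ) hL (n := 1) (m := n + 1) le_rfl (by omega)
    rw [hl]
    exact lt_of_lt_of_le (by simp [Cseq]) (prefix_spaced _ _).length_le

theorem length_runWord_pos (hL : ∀ n, 1 ≤ n → 2 ≤ L n) (n : ℕ) :
    0 < (runWord L γ n).length :=
  (length_Cseq_pos hL n).trans_le (prefix_spaced _ _).length_le

theorem length_runWord (n : ℕ) :
    (runWord L γ n).length = (γ n + 1) * (Cseq L γ n).length + γ n := by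
  rw [runWord, length_spaced_replicate]
  simp only [Bool.toNat_true]
  ring

theorem length_Cseq_succ (hL : ∀ n, 1 ≤ n → 2 ≤ L n) {n : ℕ} (hn : 1 ≤ n) :
    (Cseq L γ (n + 1)).length = L n * (runWord L γ n).length := by
  obtain ⟨k, rfl⟩ : ∃ k, n = k + 1 := ⟨n - 1, by omega⟩
  have h2 := hL (k + 1) (by omega)
  rw [Cseq_succ hL, length_spaced_replicate]
  obtain ⟨j, hj⟩ : ∃ j, L (k + 1) = j + 1 := ⟨L (k + 1) - 1, by omega⟩
  simp [hj]
  ring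

theorem complexityC_le_of_le_Cseq (hL : ∀ n, 1 ≤ n → 2 ≤ L n) {n q : ℕ} (hn : 1 ≤ n)
    (hq : 0 < q) (h : q ≤ (Cseq L γ (n + 1)).length) :
    complexityC L γ q ≤ (runWord L γ n).length + q := by
  obtain ⟨k, rfl⟩ : ∃ k, n = k + 1 := ⟨n - 1, by omega⟩
  rw [Cseq_succ hL] at h
  refine ncard_le_of_short (b := true) (length_runWord_pos hL _) hq h ?_
  rintro w ⟨hw, hw'⟩
  have := exists_infix_spaced_Cseq hL (n := k + 2) (by omega) hw'
  rw [Cseq_succ hL] at this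
  exact ⟨hw, this⟩

theorem complexityC_le_of_le_runWord (hL : ∀ n, 1 ≤ n → 2 ≤ L n) {n q : ℕ} (hn : 1 ≤ n)
    (hq : 0 < q) (h : q ≤ (runWord L γ n).length) :
    complexityC L γ q ≤ (Cseq L γ n).length + q := by
  refine ncard_le_of_short (b := false) (length_Cseq_pos hL _) hq h ?_
  rintro w ⟨hw, hw'⟩
  obtain ⟨l, -, hl⟩ := exists_infix_spaced_runWord hL hn hw'
  exact ⟨hw, l, hl⟩

theorem complexityC_le_of_le_two_mul_runWord (hL : ∀ n, 1 ≤ n → 2 ≤ L n) {n q : ℕ}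
    (hn : 1 ≤ n) (h : q ≤ 2 * (runWord L γ n).length) :
    complexityC L γ q ≤ (runWord L γ n).length + (Cseq L γ n).length + 1 +
      2 * (q - (runWord L γ n).length - 1) := by
  refine ncard_le_of_long (b := false) (length_Cseq_pos hL _) h ?_
  rintro w ⟨hw, hw'⟩
  exact ⟨hw, exists_infix_spaced_runWord hL hn hw'⟩

theorem complexityC_le_of_le_two_mul_Cseq (hL : ∀ n, 1 ≤ n → 2 ≤ L n)
    (hγ : ∀ n, 1 ≤ γ n) {n q : ℕ} (hn : 1 ≤ n) (h : q ≤ 2 * (Cseq L γ (n + 1)).length) :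
    complexityC L γ q ≤ (Cseq L γ (n + 1)).length + (runWord L γ n).length + 1 +
      2 * (q - (Cseq L γ (n + 1)).length - 1) := by
  obtain ⟨k, rfl⟩ : ∃ k, n = k + 1 := ⟨n - 1, by omega⟩
  have key : ∀ w ∈ {w : List Bool | w.length = q ∧ InLangC L γ w}, w.length = q ∧
      ∃ l, List.IsChain (fun x y => x = true ∨ y = true) l ∧
        w <:+: spaced (Cseq L γ (k + 2)) l := by
    rintro w ⟨hw, hw'⟩
    exact ⟨hw, exists_infix_spaced_Cseq_isChain hL hγ (by omega) hw'⟩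
  rw [Cseq_succ hL] at h key ⊢
  exact ncard_le_of_long (b := true) (length_runWord_pos hL _) h key

/-- For `h_{n+1} ≤ q ≤ h_{n+2}`, the ratio `p(q) / q` exceeds `3 / 2` by a small amount. -/
theorem complexityC_le_three_halves (hL : ∀ n, 1 ≤ n → 2 ≤ L n) (hγ : ∀ n, 1 ≤ γ n)
    {n q : ℕ} {δ : ℝ} (hn : 1 ≤ n) (hγδ : 2 ≤ δ * (γ (n + 1) + 1)) (hLδ : 1 ≤ δ * L n)
    (h1 : (Cseq L γ (n + 1)).length ≤ q) (h2 : q ≤ (Cseq L γ (n + 2)).length) :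
    (complexityC L γ q : ℝ) ≤ (3 / 2 + δ) * q := by
  have hA := complexityC_le_of_le_two_mul_Cseq (q := q) hL hγ hn
  have hB := complexityC_le_of_le_runWord (γ := γ) (q := q) hL (n := n + 1) (by omega)
  have hC := complexityC_le_of_le_two_mul_runWord (γ := γ) (q := q) hL (n := n + 1) (by omega)
  have hD := complexityC_le_of_le_Cseq (γ := γ) (q := q) hL (n := n + 1) (by omega)
  have hH := length_Cseq_succ (γ := γ) hL hn
  have hm' := length_runWord (L := L) (γ := γ) (n + 1)
  have hm := length_runWord_pos (γ := γ) hL n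
  have hL2 := hL n hn
  have hγ1 := hγ (n + 1)
  set H := (Cseq L γ (n + 1)).length
  set m := (runWord L γ n).length
  set m' := (runWord L γ (n + 1)).length
  set p := complexityC L γ q
  have hH2 : 2 ≤ H := by nlinarith
  have hδ : 0 < δ := by
    by_contra! h
    have : (0 : ℝ) ≤ L n := by positivity
    nlinarith
  have hmδ : (m : ℝ) ≤ δ * q := by
    have : (L n * m : ℝ) ≤ q := by exact_mod_cast hH ▸ h1
    have hm0 : (0 : ℝ) ≤ m := by positivity
    nlinarith
  have hq0 : (0 : ℝ) ≤ δ * q := by positivity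
  rcases le_total q (2 * H) with hq | hq
  · have : 2 * p ≤ 3 * q + 2 * m := by have := hA hq; omega
    have : (2 * p : ℝ) ≤ 3 * q + 2 * m := by exact_mod_cast this
    linarith
  rcases le_total q m' with hq' | hq'
  · have : 2 * p ≤ 3 * q := by have := hB (by omega) hq'; omega
    have : (2 * p : ℝ) ≤ 3 * q := by exact_mod_cast this
    linarith
  rcases le_total q (2 * m') with hq2 | hq2
  · have : 2 * p ≤ 3 * q + 2 * (H + 1) := by have := hC hq2; omega
    have : (2 * p : ℝ) ≤ 3 * q + 2 * (H + 1) := by exact_mod_cast this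
    have h3 : (γ (n + 1) + 1) * (H + 1) ≤ 2 * q := by nlinarith
    have h3 : ((γ (n + 1) + 1) * (H + 1) : ℝ) ≤ 2 * q := by exact_mod_cast h3
    have hH0 : (0 : ℝ) ≤ H := by positivity
    nlinarith
  · have : 2 * p ≤ 3 * q := by have := hD (by omega) h2; omega
    have : (2 * p : ℝ) ≤ 3 * q := by exact_mod_cast this
    linarith

end Language

/-- Given a rule `c` for choosing the next cut parameter from the current length, the
sequence of lengths it produces. -/
def lengthRec (g : ℕ) (c : ℕ → ℕ → ℕ) : ℕ → ℕ
  | 0 => 1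
  | 1 => 1
  | n + 2 => c (n + 1) (lengthRec g c (n + 1)) * ((g + 1) * lengthRec g c (n + 1) + g)

/-- A cut sequence may be chosen recursively in terms of the lengths of the words built. -/
theorem exists_cut_sequence (g : ℕ) (c : ℕ → ℕ → ℕ) (hc : ∀ n h, 2 ≤ c n h) :
    ∃ L : ℕ → ℕ, ∀ n, 1 ≤ n → L n = c n (Cseq L (fun _ => g) n).length := by
  let L : ℕ → ℕ := fun n => c n (lengthRec g c n)
  have hL : ∀ n, 1 ≤ n → 2 ≤ L n := fun n _ => hc _ _
  refine ⟨L, fun n hn => ?_⟩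
  suffices h : (Cseq L (fun _ => g) n).length = lengthRec g c n by rw [h]
  induction n, hn using Nat.le_induction with
  | base => rfl
  | succ n hn ih =>
    rw [length_Cseq_succ hL hn, length_runWord, ih]
    obtain ⟨k, rfl⟩ : ∃ k, n = k + 1 := ⟨n - 1, by omega⟩
    rfl

/-- For every `ε > 0` and every `f : ℕ → ℝ` with `f(q) → ∞`, there are an integer `γ ≥ 2`
and a sequence `L_n ≥ 2` with `L_n → ∞` such that the subshift built from the constant
sequence `γ` and the cut sequence `L` satisfies `limsup p(q)/q < 3/2 + ε` and
`p(h_n) < h_n + f(h_n)` for all `n ≥ 2`. -/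
theorem stmt18 (ε : ℝ) (hε : 0 < ε) (f : ℕ → ℝ) (hf : Tendsto f atTop atTop) :
    ∃ γ₀ : ℕ, 2 ≤ γ₀ ∧ ∃ L : ℕ → ℕ, (∀ n, 1 ≤ n → 2 ≤ L n) ∧
      Tendsto L atTop atTop ∧
      atTop.limsup (fun q : ℕ =>
          (complexityC L (fun _ => γ₀) q : ℝ) / (q : ℝ)) < 3 / 2 + ε ∧
      ∀ n, 2 ≤ n →
        (complexityC L (fun _ => γ₀) ((Cseq L (fun _ => γ₀) n).length) : ℝ) <
          ((Cseq L (fun _ => γ₀) n).length : ℝ) +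
            f ((Cseq L (fun _ => γ₀) n).length) := by
  obtain ⟨g, hg⟩ := exists_nat_gt (4 / ε + 2)
  have hg2 : 2 ≤ g := by
    have : (2 : ℝ) < g := lt_trans (by linarith [show 0 < 4 / ε by positivity]) hg
    exact_mod_cast this.le
  have hex : ∀ n h : ℕ, ∃ c : ℕ, 2 ≤ c ∧ n ≤ c ∧
      ∀ x, c ≤ x → (((g + 1) * h + g : ℕ) : ℝ) < f x := by
    intro n h
    obtain ⟨a, ha⟩ := eventually_atTop.mp (hf.eventually_gt_atTop (((g + 1) * h + g : ℕ) : ℝ))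
    exact ⟨max (max 2 n) a, by simp, by simp, fun x hx => ha x (le_trans (by simp) hx)⟩
  choose c hc2 hcn hcf using hex
  obtain ⟨L, hLc⟩ := exists_cut_sequence g c hc2
  have hL : ∀ n, 1 ≤ n → 2 ≤ L n := fun n hn => hLc n hn ▸ hc2 _ _
  have hLn : ∀ n, n ≤ L n := by
    intro n
    rcases Nat.eq_zero_or_pos n with rfl | hn
    · exact Nat.zero_le _
    · exact (hcn n _).trans_eq (hLc n hn).symm
  set γ : ℕ → ℕ := fun _ => g
  have hlen : ∀ n, 1 ≤ n → L n ≤ (Cseq L γ (n + 1)).length := by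
    intro n hn
    rw [length_Cseq_succ hL hn]
    exact Nat.le_mul_of_pos_right _ (length_runWord_pos hL n)
  refine ⟨g, hg2, L, hL, tendsto_atTop_mono hLn tendsto_id, ?_, ?_⟩
  · have hε2 : 0 < ε / 2 := by positivity
    have hev : ∀ᶠ q : ℕ in atTop, (complexityC L γ q : ℝ) / q ≤ 3 / 2 + ε / 2 := by
      obtain ⟨N, hN⟩ := exists_nat_gt (2 / ε)
      have hNε : 1 ≤ ε / 2 * N := by
        rw [div_lt_iff₀ hε] at hN
        linarith
      have hgε : (2 : ℝ) ≤ ε / 2 * (g + 1) := by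
        have : 4 / ε < g := by linarith
        rw [div_lt_iff₀ hε] at this
        linarith
      filter_upwards [eventually_ge_atTop (Cseq L γ (N + 2)).length] with q hq
      have hq0 : 0 < q := (length_Cseq_pos hL _).trans_le hq
      obtain ⟨n, hnN, h1, h2⟩ : ∃ n, N + 1 ≤ n ∧ (Cseq L γ (n + 1)).length ≤ q ∧
          q ≤ (Cseq L γ (n + 2)).length := by
        by_contra! hcon
        have hall : ∀ n, N + 1 ≤ n → (Cseq L γ (n + 1)).length ≤ q := by
          intro n hn
          induction n, hn using Nat.le_induction with
          | base => exact hq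
          | succ n hn ih => exact (hcon n hn ih).le
        have h3 := hall (q + N + 1) (by omega)
        have h4 := hlen (q + N + 1) (by omega)
        have h5 := hLn (q + N + 1)
        omega
      rw [div_le_iff₀ (by exact_mod_cast hq0)]
      refine complexityC_le_three_halves hL (fun _ => (by omega : 1 ≤ g)) (n := n) (by omega) hgε ?_ h1 h2
      have : (N : ℝ) ≤ L n := by exact_mod_cast (by omega : N ≤ n).trans (hLn n)
      nlinarith
    refine (limsup_le_of_le ?_ hev).trans_lt (by linarith)
    exact (isBoundedUnder_of ⟨0, fun q => by positivity⟩ :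
      IsBoundedUnder (· ≥ ·) atTop _).isCoboundedUnder_le
  · intro n hn
    obtain ⟨k, rfl⟩ : ∃ k, n = k + 1 := ⟨n - 1, by omega⟩
    have hk : 1 ≤ k := by omega
    have h1 := complexityC_le_of_le_Cseq (γ := γ) hL hk (length_Cseq_pos hL (k + 1)) le_rfl
    have h2 := hcf k (Cseq L γ k).length _ ((hLc k hk).symm.trans_le (hlen k hk))
    rw [← length_runWord (L := L) (γ := γ) k] at h2
    have h1' : (complexityC L γ (Cseq L γ (k + 1)).length : ℝ) ≤
        (runWord L γ k).length + (Cseq L γ (k + 1)).length := by exact_mod_cast h1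
    linarith
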